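/- arXiv:nlin/0306040 — 3 statements merged into one kernel-verified Lean document; each statement's English description precedes it below -/
import Mathlib

section
/- Let Q = {0,…,q−1}, let f : Q^n → Q be a local rule with f(0,…,0) = 0, and let F : Q^ℤ → Q^ℤ be the cellular automaton F(c)_i = f(c_i,…,c_{i+n−1}). Let b ≥ 1 and φ : Q^b → ℝ with φ(0,…,0) = 0. Then the following are equivalent: (a) for every p ≥ 1 and every p-periodic configuration c ∈ Q^ℤ, ∑_{k=0}^{p−1} φ(F(c)_k,…,F(c)_{k+b−1}) ≤ ∑_{k=0}^{p−1} φ(c_k,…,c_{k+b−1}); (b) for every finite configuration c ∈ Q^ℤ, ∑_{k∈ℤ} φ(F(c)_k,…,F(c)_{k+b−1}) ≤ ∑_{k∈ℤ} φ(c_k,…,c_{k+b−1}), both sums having only finitely many nonzero terms. -/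
/-- The sum of `w` over the `L` consecutive length-`m` windows of `c` starting at `s`. -/
def windowSum {α : Type*} {m : ℕ} (w : (Fin m → α) → ℝ) (c : ℤ → α) (s : ℤ) (L : ℕ) : ℝ :=
  ∑ k ∈ Finset.range L, w (fun j => c (s + (k : ℤ) + ((j : ℕ) : ℤ)))

theorem finsum_eq_sum_range_of_eq_zero (h : ℤ → ℝ) (s : ℤ) (L : ℕ)
    (hh : ∀ k, (k < s ∨ s + L ≤ k) → h k = 0) :
    ∑ᶠ k, h k = ∑ k ∈ Finset.range L, h (s + (k : ℤ)) := by
  rw [finsum_eq_sum_of_support_subset (s := (Finset.range L).image fun k : ℕ => s + (k : ℤ)),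
    Finset.sum_image]
  · intro x _ y _ hxy
    simpa using hxy
  · intro k hk
    have h1 : ¬ (k < s ∨ s + L ≤ k) := fun h2 => hk (hh k h2)
    simp only [Finset.coe_image, Set.mem_image, Finset.mem_coe, Finset.mem_range]
    exact ⟨(k - s).toNat, by omega, by omega⟩

theorem exists_bounds_of_finite {α : Type*} [Zero α] {c : ℤ → α}
    (hc : {i : ℤ | c i ≠ 0}.Finite) : ∃ N : ℕ, ∀ i : ℤ, (i < -N ∨ (N : ℤ) ≤ i) → c i = 0 := by
  obtain ⟨l, hl⟩ := hc.bddBelow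
  obtain ⟨u, hu⟩ := hc.bddAbove
  refine ⟨l.natAbs + u.natAbs + 1, fun i hi => ?_⟩
  by_contra h
  have h1 : l ≤ i := hl h
  have h2 : i ≤ u := hu h
  omega

section Window

variable {α : Type*} {m : ℕ} {w : (Fin m → α) → ℝ}

theorem windowSum_add (w : (Fin m → α) → ℝ) (c : ℤ → α) (s : ℤ) (L L' : ℕ) :
    windowSum w c s (L + L') = windowSum w c s L + windowSum w c (s + L) L' := by
  simp [windowSum, Finset.sum_range_add, add_assoc]

theorem windowSum_congr {c c' : ℤ → α} {s s' : ℤ} {L : ℕ}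
    (h : ∀ k t : ℕ, k < L → t < m → c (s + k + t) = c' (s' + k + t)) :
    windowSum w c s L = windowSum w c' s' L :=
  Finset.sum_congr rfl fun k hk => congrArg w <| funext fun j =>
    h k j (Finset.mem_range.1 hk) j.2

theorem windowSum_le {B : ℝ} (hB : ∀ u, w u ≤ B) (c : ℤ → α) (s : ℤ) (L : ℕ) :
    windowSum w c s L ≤ L * B := by
  refine (Finset.sum_le_card_nsmul _ _ B fun _ _ => hB _).trans ?_
  simp

theorem windowSum_mul_period {c : ℤ → α} {p : ℕ} (hc : ∀ i : ℤ, c (i + p) = c i) (M : ℕ) :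
    windowSum w c 0 (M * p) = M * windowSum w c 0 p := by
  induction M with
  | zero => simp [windowSum]
  | succ M ih =>
    have hM : ∀ i : ℤ, c (i + M * p) = c i := by
      intro i
      have := (show Function.Periodic c (p : ℤ) from hc).nat_mul M i
      simpa using this
    have h : windowSum w c (0 + (M * p : ℕ)) p = windowSum w c 0 p := by
      refine windowSum_congr fun k t _ _ => ?_
      rw [← hM (0 + k + t)]
      congr 1
      push_cast
      ring
    rw [Nat.succ_mul, windowSum_add, ih, h]
    push_cast
    ring

variable [Zero α]

theorem finsum_window_eq_windowSum (hw : w (fun _ => 0) = 0) {c : ℤ → α} {s e : ℤ} {L : ℕ}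
    (hc : ∀ i, (i < s + m ∨ e ≤ i) → c i = 0) (he : e ≤ s + L) :
    ∑ᶠ k : ℤ, w (fun j => c (k + ((j : ℕ) : ℤ))) = windowSum w c s L := by
  refine finsum_eq_sum_range_of_eq_zero _ s L fun k hk => ?_
  rw [← hw]
  congr 1
  funext j
  have := j.2
  exact hc _ (by omega)

theorem finite_support_window (hw : w (fun _ => 0) = 0) {c : ℤ → α}
    (hc : {i : ℤ | c i ≠ 0}.Finite) :
    (Function.support fun k : ℤ => w (fun j => c (k + ((j : ℕ) : ℤ)))).Finite := by
  obtain ⟨N, hN⟩ := exists_bounds_of_finite hc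
  refine (Set.finite_Ico (-N - m : ℤ) N).subset fun k hk => ?_
  by_contra hk'
  refine hk ?_
  change w _ = 0
  rw [← hw]
  congr 1
  funext j
  have := j.2
  refine hN _ ?_
  simp only [Set.mem_Ico] at hk'
  omega

theorem windowSum_nonneg_iff_finsum_nonneg [Finite α] (hw : w (fun _ => 0) = 0) :
    (∀ p : ℕ, 1 ≤ p → ∀ c : ℤ → α, (∀ i : ℤ, c (i + p) = c i) → 0 ≤ windowSum w c 0 p) ↔
    ∀ c : ℤ → α, {i : ℤ | c i ≠ 0}.Finite → 0 ≤ ∑ᶠ k : ℤ, w (fun j => c (k + ((j : ℕ) : ℤ))) := by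
  constructor
  · intro h c hc
    obtain ⟨N, hN⟩ := exists_bounds_of_finite hc
    obtain ⟨p, hp⟩ : ∃ p : ℕ, p = 2 * N + m + 1 := ⟨_, rfl⟩
    rw [finsum_window_eq_windowSum hw (s := -N - m) (e := N) (L := p)
      (fun i hi => hN i (by omega)) (by omega)]
    have h1 := h p (by omega) (fun i => c (-N - m + i % p)) (fun i => by simp)
    refine h1.trans_eq (windowSum_congr fun k t hk ht => ?_)
    rcases lt_or_ge (k + t) p with hkt | hkt
    · rw [Int.emod_eq_of_lt (by omega) (by omega)]
      congr 1
      ring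
    · have h2 : ((0 : ℤ) + k + t) % p = k + t - p := by
        rw [← Int.sub_emod_right, Int.emod_eq_of_lt (by omega) (by omega)]
        ring
      rw [h2, hN _ (by omega), hN _ (by omega)]
  · intro h p hp c hc
    obtain ⟨B, hB⟩ := (Set.finite_range w).bddAbove
    replace hB : ∀ u, w u ≤ B := fun u => hB ⟨u, rfl⟩
    have key : ∀ M : ℕ, 0 ≤ M * windowSum w c 0 p + 2 * (m * B) := by
      intro M
      obtain ⟨d, hd⟩ : ∃ d : ℤ → α, d = fun i : ℤ =>
        if 0 ≤ i ∧ i < (M * p : ℕ) + m then c i else 0 := ⟨_, rfl⟩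
      have hd0 : ∀ i, (i < -(m : ℤ) + m ∨ ((M * p : ℕ) + m : ℤ) ≤ i) → d i = 0 := by
        intro i hi
        rw [hd]
        exact if_neg (by omega)
      have hfin : {i : ℤ | d i ≠ 0}.Finite := by
        refine (Set.finite_Ico (0 : ℤ) ((M * p : ℕ) + m)).subset fun i hi => ?_
        by_contra hi'
        simp only [Set.mem_Ico] at hi'
        exact hi (hd0 i (by omega))
      have h1 := h d hfin
      rw [finsum_window_eq_windowSum hw (L := m + M * p + m) hd0 (by push_cast; linarith),
        windowSum_add, windowSum_add] at h1
      have h2 : windowSum w d (-(m : ℤ) + m) (M * p) = windowSum w c 0 (M * p) := by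
        refine windowSum_congr fun k t hk ht => ?_
        rw [neg_add_cancel, hd]
        exact if_pos (by omega)
      rw [h2, windowSum_mul_period hc] at h1
      have h3 := windowSum_le hB d (-(m : ℤ)) m
      have h4 := windowSum_le hB d (-(m : ℤ) + (m + M * p : ℕ)) m
      linarith
    by_contra! hneg
    obtain ⟨M, hM⟩ := exists_nat_gt (2 * (m * B) / -windowSum w c 0 p)
    rw [div_lt_iff₀ (by linarith)] at hM
    have := key M
    linarith

end Window


/-- Equivalence between the non-increasing condition for an additive quantity
on periodic configurations and on finite configurations. -/
theorem periodic_nonincreasing_iff_finite_nonincreasing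
    (q n b : ℕ) [NeZero q] (hn : 1 ≤ n) (hb : 1 ≤ b)
    (f : (Fin n → Fin q) → Fin q) (hf0 : f (fun _ => 0) = 0)
    (φ : (Fin b → Fin q) → ℝ) (hφ0 : φ (fun _ => 0) = 0)
    (F : (ℤ → Fin q) → ℤ → Fin q)
    (hF : ∀ (c : ℤ → Fin q) (i : ℤ), F c i = f (fun t => c (i + ((t : ℕ) : ℤ)))) :
    (∀ p : ℕ, 1 ≤ p → ∀ c : ℤ → Fin q, (∀ i : ℤ, c (i + (p : ℤ)) = c i) →
        ∑ k ∈ Finset.range p, φ (fun j => F c ((k : ℤ) + ((j : ℕ) : ℤ))) ≤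
        ∑ k ∈ Finset.range p, φ (fun j => c ((k : ℤ) + ((j : ℕ) : ℤ)))) ↔
    (∀ c : ℤ → Fin q, {i : ℤ | c i ≠ 0}.Finite →
        ∑ᶠ k : ℤ, φ (fun j => F c (k + ((j : ℕ) : ℤ))) ≤
        ∑ᶠ k : ℤ, φ (fun j => c (k + ((j : ℕ) : ℤ)))) := by
  have hFc : ∀ (c : ℤ → Fin q) (k : ℤ), φ (fun j => F c (k + ((j : ℕ) : ℤ))) =
      φ (fun j => f fun t => c (k + (((j : ℕ) + (t : ℕ) : ℕ) : ℤ))) := by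
    intro c k
    simp only [hF, Nat.cast_add, add_assoc]
  let w₁ : (Fin (b + n) → Fin q) → ℝ := fun u => φ fun j => u (Fin.castAdd n j)
  let w₂ : (Fin (b + n) → Fin q) → ℝ := fun u =>
    φ fun j => f fun t => u ⟨(j : ℕ) + (t : ℕ), by omega⟩
  have hw₁ : w₁ (fun _ => 0) = 0 := hφ0
  have hw₂ : w₂ (fun _ => 0) = 0 := by simp only [w₂, hf0, hφ0]
  have key := windowSum_nonneg_iff_finsum_nonneg (w := fun u => w₁ u - w₂ u)
    (by simp only [hw₁, hw₂, sub_zero])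
  simp only [hFc]
  refine Iff.trans ?_ (key.trans ?_)
  · refine forall₄_congr fun p _ c _ => ?_
    rw [← sub_nonneg, ← Finset.sum_sub_distrib]
    simp only [windowSum, zero_add]
    rfl
  · refine forall₂_congr fun c hc => ?_
    rw [finsum_sub_distrib (finite_support_window hw₁ hc) (finite_support_window hw₂ hc),
      sub_nonneg]
    rfl
end

section
/- Let Q = {0,…,q−1} and f : Q^n → Q. If for all (x_1,…,x_n) ∈ Q^n one has f(x_1,…,x_n) ≤ x_1 + ∑_{k=1}^{n−1} [ f(0^{n−k}, x_2,…,x_{k+1}) − f(0^{n−k}, x_1,…,x_k) ] (where 0^{n−k} denotes n−k consecutive zeros), then f is non-increasing (f ∈ CA^-(q,n)). -/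
/-- A local rule `f ∈ CA(q,n)` is conservative (`f ∈ CA^0(q,n)`) if for every period
`p ≥ 1` and every `p`-periodic (circular) word `w`, the sum of the images over one period
equals the sum of the states over one period. -/
def Conserves (q n : ℕ) (f : (Fin n → Fin q) → Fin q) : Prop :=
  ∀ p : ℕ, 1 ≤ p → ∀ w : ℤ → Fin q, (∀ i : ℤ, w (i + (p : ℤ)) = w i) →
    ∑ k ∈ Finset.range p, ((f (fun t => w ((k : ℤ) + ((t : ℕ) : ℤ)))) : ℤ) =
    ∑ k ∈ Finset.range p, ((w (k : ℤ)) : ℤ)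

/-- A local rule `f ∈ CA(q,n)` is non-increasing (`f ∈ CA^-(q,n)`) if for every period
`p ≥ 1` and every `p`-periodic (circular) word `w`, the sum of the images over one period
is at most the sum of the states over one period. -/
def NonIncreasing (q n : ℕ) (f : (Fin n → Fin q) → Fin q) : Prop :=
  ∀ p : ℕ, 1 ≤ p → ∀ w : ℤ → Fin q, (∀ i : ℤ, w (i + (p : ℤ)) = w i) →
    ∑ k ∈ Finset.range p, ((f (fun t => w ((k : ℤ) + ((t : ℕ) : ℤ)))) : ℤ) ≤
    ∑ k ∈ Finset.range p, ((w (k : ℤ)) : ℤ)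

/-- the Boccara–Fukś inequality is a sufficient condition for a rule to be
non-increasing.  Words of length `n` are encoded as functions `ℕ → Fin q` (only
coordinates `0,…,n-1` are read); `g` is `f` read on the first `n` coordinates, and
`pad m y` is the word `0^m y_0 y_1 ⋯`. -/
theorem sufficient_condition_nonincreasing
    (q n : ℕ) [NeZero q] (hn : 1 ≤ n)
    (f : (Fin n → Fin q) → Fin q)
    (g : (ℕ → Fin q) → Fin q) (hg : ∀ y, g y = f (fun t => y (t : ℕ)))
    (pad : ℕ → (ℕ → Fin q) → ℕ → Fin q)
    (hpad : ∀ m y t, pad m y t = if t < m then 0 else y (t - m))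
    (hineq : ∀ x : ℕ → Fin q,
        ((g x : ℤ)) ≤ ((x 0 : ℤ)) +
          ∑ k ∈ Finset.Icc 1 (n - 1),
            (((g (pad (n - k) (fun t => x (t + 1)))) : ℤ) - ((g (pad (n - k) x)) : ℤ))) :
    NonIncreasing q n f := by
  intro p _ w hw
  let F : ℕ → ℕ → ℤ := fun k j => ((g (pad (n - k) fun t => w ((j : ℤ) + (t : ℤ)))) : ℤ)
  have hF : ∀ k, F k p = F k 0 := fun k => by
    have h : (fun t : ℕ => w ((p : ℤ) + (t : ℤ))) = fun t : ℕ => w (((0 : ℕ) : ℤ) + (t : ℤ)) := by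
      funext t
      rw [Nat.cast_zero, zero_add, add_comm, hw]
    simp only [F, h]
  have hstep : ∀ j : ℕ, ((f (fun t => w ((j : ℤ) + ((t : ℕ) : ℤ)))) : ℤ) ≤
      (w (j : ℤ) : ℤ) + ∑ k ∈ Finset.Icc 1 (n - 1), (F k (j + 1) - F k j) := fun j => by
    have h := hineq fun t => w ((j : ℤ) + (t : ℤ))
    rw [hg] at h
    have hshift : (fun t : ℕ => w ((j : ℤ) + ((t + 1 : ℕ) : ℤ))) =
        fun t : ℕ => w (((j + 1 : ℕ) : ℤ) + (t : ℤ)) := by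
      funext t
      congr 1
      push_cast
      ring
    simpa only [hshift, Nat.cast_zero, add_zero] using h
  refine (Finset.sum_le_sum fun j _ => hstep j).trans_eq ?_
  rw [Finset.sum_add_distrib, Finset.sum_comm]
  simp only [Finset.sum_range_sub, hF, sub_self, Finset.sum_const_zero, add_zero]
end

section
/- Let Q = {0,…,q−1}, let f : Q^n → Q be state-conserving (for every p ≥ 1, every circular word w : ℤ/pℤ → Q, and every α ∈ Q, the number of positions k with f(w_k,…,w_{k+n−1}) = α equals the number of positions k with w_k = α, indices mod p), and let F : Q^ℤ → Q^ℤ be the CA F(c)_i = f(c_i,…,c_{i+n−1}). Then state-conservation is local: there exists an integer L ≥ 0 (depending only on q and n) such that for every configuration c ∈ Q^ℤ, every i ∈ ℤ, and every α ∈ Q with c_i = α, there exists j ∈ ℤ with |j − i| ≤ L and F(c)_j = α. -/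
/-- `delta α x = 1` if `x = α` and `0` otherwise. -/
def delta {q : ℕ} (α x : Fin q) : ℤ := if x = α then 1 else 0

/-- A local rule `f ∈ CA(q,n)` is state-conserving if, for every period `p ≥ 1`, every
`p`-periodic (circular) word `w` and every state `α`, the number of cells in state `α`
over one period is preserved by the rule. -/
def StateConserving (q n : ℕ) (f : (Fin n → Fin q) → Fin q) : Prop :=
  ∀ p : ℕ, 1 ≤ p → ∀ w : ℤ → Fin q, (∀ i : ℤ, w (i + (p : ℤ)) = w i) → ∀ α : Fin q,
    ∑ k ∈ Finset.range p, delta α (f (fun t => w ((k : ℤ) + ((t : ℕ) : ℤ)))) =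
    ∑ k ∈ Finset.range p, delta α (w (k : ℤ))

theorem delta_nonneg {q : ℕ} (α x : Fin q) : 0 ≤ delta α x := by
  unfold delta; split_ifs <;> simp

theorem delta_eq_zero_iff {q : ℕ} {α x : Fin q} : delta α x = 0 ↔ x ≠ α := by
  simp [delta]

/-- Under a state-conserving rule, a circular word avoids `α` iff its image does. -/
theorem StateConserving.forall_ne_iff {q n : ℕ} {f : (Fin n → Fin q) → Fin q}
    (hf : StateConserving q n f) {p : ℕ} (hp : 1 ≤ p) {w : ℤ → Fin q}
    (hw : ∀ i : ℤ, w (i + (p : ℤ)) = w i) (α : Fin q) :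
    (∀ k < p, f (fun t => w ((k : ℤ) + ((t : ℕ) : ℤ))) ≠ α) ↔ ∀ k < p, w (k : ℤ) ≠ α := by
  have h := hf p hp w hw α
  have key : ∀ g : ℕ → Fin q,
      (∀ k < p, g k ≠ α) ↔ ∑ k ∈ Finset.range p, delta α (g k) = 0 := fun g => by
    rw [Finset.sum_eq_zero_iff_of_nonneg fun _ _ => delta_nonneg _ _]
    simp only [Finset.mem_range, delta_eq_zero_iff]
  rw [key fun k => f (fun t => w ((k : ℤ) + ((t : ℕ) : ℤ))), key fun k => w (k : ℤ), h]

/-- A stretch of a configuration, closed up by a repeated `n`-letter word, avoids `α` when its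
image does. -/
theorem StateConserving.ne_of_repeat {q n : ℕ} {f : (Fin n → Fin q) → Fin q}
    (hf : StateConserving q n f) {α : Fin q} {c : ℤ → Fin q} {a : ℤ} {p : ℕ}
    (hp : 1 ≤ p) (hnp : n ≤ p)
    (hrep : ∀ t : ℕ, t < n → c (a + p + t) = c (a + t))
    (hout : ∀ k < p, f (fun t => c (a + (k : ℤ) + ((t : ℕ) : ℤ))) ≠ α) :
    ∀ k < p, c (a + (k : ℤ)) ≠ α := by
  have hmod : ∀ k : ℕ, k < p → (k : ℤ) % (p : ℤ) = k := fun k hk =>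
    Int.emod_eq_of_lt (by omega) (by omega)
  have h := (hf.forall_ne_iff hp (w := fun i => c (a + i % (p : ℤ)))
    (fun i => by simp) α).1 fun k hk => by
      convert hout k hk using 3 with t
      obtain ⟨t, ht⟩ := t
      by_cases hkt : k + t < p
      · rw [← Nat.cast_add, hmod _ hkt]
        congr 1; push_cast; ring
      · obtain ⟨r, hr⟩ := Nat.exists_eq_add_of_le (not_lt.1 hkt)
        have e : (k : ℤ) + (t : ℤ) = r + p := by omega
        rw [e, Int.add_emod_right, hmod r (by omega), add_assoc, e, ← hrep r (by omega)]
        congr 1; ring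
  intro k hk
  have := h k hk
  simpa only [hmod k hk] using this

/-- A sufficiently long stretch whose image avoids `α` contains `n` consecutive cells
avoiding `α`. -/
theorem StateConserving.exists_window_ne {q n : ℕ} (hn : 1 ≤ n) {f : (Fin n → Fin q) → Fin q}
    (hf : StateConserving q n f) {α : Fin q} {c : ℤ → Fin q} {s : ℤ}
    (hout : ∀ j : ℤ, s ≤ j → j < s + (n * q ^ n : ℕ) →
      f (fun t => c (j + ((t : ℕ) : ℤ))) ≠ α) :
    ∃ a : ℤ, s ≤ a ∧ a ≤ s + (n * q ^ n : ℕ) ∧ ∀ t < n, c (a + (t : ℤ)) ≠ α := by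
  let g : Fin (q ^ n + 1) → (Fin n → Fin q) := fun k t => c (s + (n * k : ℕ) + ((t : ℕ) : ℤ))
  obtain ⟨k, l, hkl, hg⟩ : ∃ k l, k < l ∧ g k = g l := by
    obtain ⟨k, l, hne, hg⟩ := Fintype.exists_ne_map_eq_of_card_lt g (by simp)
    rcases lt_or_gt_of_ne hne with h | h
    exacts [⟨k, l, h, hg⟩, ⟨l, k, h, hg.symm⟩]
  obtain ⟨d, hd, hld⟩ : ∃ d : ℕ, 1 ≤ d ∧ (l : ℕ) = k + d :=
    ⟨l - k, by have := Fin.lt_def.1 hkl; omega, by have := Fin.lt_def.1 hkl; omega⟩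
  have hnd : n ≤ n * d := Nat.le_mul_of_pos_right n hd
  have hl : n * k + n * d ≤ n * q ^ n := by
    rw [← mul_add, ← hld]
    exact Nat.mul_le_mul_left n (Nat.lt_succ_iff.1 l.2)
  refine ⟨s + (n * k : ℕ), by omega, by omega, fun t ht =>
    hf.ne_of_repeat (p := n * d) (by omega) hnd (fun t ht => ?_) (fun k hk => ?_) t (by omega)⟩
  · have := congrFun hg ⟨t, ht⟩
    simp only [g, hld, mul_add] at this
    rw [this]
    congr 1; push_cast; ring
  · exact hout _ (by omega) (by omega)

/-- If `n` consecutive cells from `a` and from `b` avoid `α`, and so does the image on `[a, b]`,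
then the cells in between avoid `α` too. -/
theorem StateConserving.ne_between {q n : ℕ} (hn : 1 ≤ n) {f : (Fin n → Fin q) → Fin q}
    (hf : StateConserving q n f) {α : Fin q} {c : ℤ → Fin q} {a : ℤ} {m : ℕ}
    (ha : ∀ t < n, c (a + (t : ℤ)) ≠ α) (hb : ∀ t < n, c (a + m + (t : ℤ)) ≠ α)
    (hout : ∀ k ≤ m, f (fun t => c (a + (k : ℤ) + ((t : ℕ) : ℤ))) ≠ α) :
    ∀ k < m + n, c (a + (k : ℤ)) ≠ α := by
  let v : ℤ → Fin q := fun i =>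
    if i % (2 * n : ℕ) < n then c (a + m + i % (2 * n : ℕ)) else c (a + (i % (2 * n : ℕ) - n))
  let w : ℤ → Fin q := fun i => c (a + i % (m + n : ℕ))
  have hv : ∀ k < 2 * n,
      v (k : ℤ) = if k < n then c (a + m + (k : ℤ)) else c (a + ((k : ℤ) - n)) := fun k hk => by
    simp only [v, Int.emod_eq_of_lt (Int.natCast_nonneg k) (Int.ofNat_lt.2 hk), Nat.cast_lt]
  have hw : ∀ k < m + n, w (k : ℤ) = c (a + k) := fun k hk => by
    simp only [w, Int.emod_eq_of_lt (Int.natCast_nonneg k) (Int.ofNat_lt.2 hk)]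
  have hwper : ∀ i : ℤ, w (i + (m + n : ℕ)) = w i := fun i => by
    simp only [w, Int.add_emod_right]
  have hvout := (hf.forall_ne_iff (p := 2 * n) (by omega) (w := v)
    (fun i => by simp only [v, Int.add_emod_right]) α).2 fun k hk => by
      rw [hv k hk]
      split_ifs with h
      · exact hb k h
      · have := ha (k - n) (by omega)
        rwa [Nat.cast_sub (not_lt.1 h)] at this
  have hwout := (hf.forall_ne_iff (p := m + n) (by omega) hwper α).1 fun k hk => by
    rcases lt_or_ge k m with hkm | hkm
    · convert hout k hkm.le using 3 with t
      rw [← Nat.cast_add, hw _ (by omega)]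
      congr 1; push_cast; ring
    · obtain ⟨r, rfl⟩ := Nat.exists_eq_add_of_le hkm
      convert hvout r (by omega) using 3 with t
      rw [← Nat.cast_add, ← Nat.cast_add, hv _ (by omega)]
      split_ifs with h
      · rw [hw _ (by omega)]
        congr 1; push_cast; ring
      · have e : ((m + r + t : ℕ) : ℤ) = (r + t - n : ℕ) + (m + n : ℕ) := by omega
        rw [e, hwper, hw _ (by omega)]
        congr 1; omega
  exact fun k hk => hw k hk ▸ hwout k hk

/-- state conservation is local: there is a bound `L` such that in the
image of any configuration, a state `α` reappears within distance `L` of each of its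
occurrences. -/
theorem state_conservation_is_local
    (q n : ℕ) [NeZero q] (hn : 1 ≤ n)
    (f : (Fin n → Fin q) → Fin q)
    (hf : StateConserving q n f)
    (F : (ℤ → Fin q) → ℤ → Fin q)
    (hF : ∀ (c : ℤ → Fin q) (i : ℤ), F c i = f (fun t => c (i + ((t : ℕ) : ℤ)))) :
    ∃ L : ℕ, ∀ (c : ℤ → Fin q) (i : ℤ) (α : Fin q), c i = α →
      ∃ j : ℤ, |j - i| ≤ (L : ℤ) ∧ F c j = α := by
  refine ⟨n * q ^ n, fun c i α hi => ?_⟩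
  by_contra! hne
  replace hne : ∀ j : ℤ, i - (n * q ^ n : ℕ) ≤ j → j ≤ i + (n * q ^ n : ℕ) →
      f (fun t => c (j + ((t : ℕ) : ℤ))) ≠ α := fun j h₁ h₂ => by
    rw [← hF]
    exact hne j (abs_le.2 ⟨by omega, by omega⟩)
  obtain ⟨a, ha, ha', hca⟩ := hf.exists_window_ne hn (s := i - (n * q ^ n : ℕ))
    fun j h₁ h₂ => hne j h₁ (by omega)
  obtain ⟨b, hb, hb', hcb⟩ := hf.exists_window_ne hn (s := i)
    fun j h₁ h₂ => hne j (by omega) h₂.le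
  obtain ⟨m, hm⟩ := Int.le.dest (show a ≤ b by omega)
  obtain ⟨k, hk⟩ := Int.le.dest (show a ≤ i by omega)
  subst hm
  refine hf.ne_between hn hca hcb (fun k hk => hne _ (by omega) (by omega)) k (by omega) ?_
  rw [hk, hi]
end
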